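/- arXiv:2204.08122 — 8 statements merged into one kernel-verified Lean document; each statement's English description precedes it below -/
import Mathlib

section
/- Fix μ ∈ ℝ and τ², a, b > 0, set t = (1/τ² + 1)⁻¹ and v = (μ/τ²)·t/(1 − t), and let p(z∣x) denote the posterior predictive density of the Normal working model given the single observation x evaluated at z. Then for all y₁, y₂ ∈ ℝ the following are equivalent: (i) p(y₂∣y₁) ≤ p(y₁∣y₂); (ii) b_{y₁} ≤ b_{y₂}; (iii) (y₁ − v)² ≤ (y₂ − v)². -/
/-- The posterior predictive density `p(z ∣ x)` of the Normal working model
(sampling model `N(θ, σ²)`, prior `θ ~ N(μ, τ²σ²)`, `σ² ~ IG(a/2, b/2)`) given the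
single observation `x`, evaluated at `z`:
`p(z∣x) = Γ((a+2)/2)/(√((a+1)π)·Γ((a+1)/2)) · (b_x(1+t)/(a+1))^(−1/2)
          · (1 + (z − μ_x)²/(b_x(1+t)))^(−(a+2)/2)`
where `t = (1/τ² + 1)⁻¹`, `μ_x = (μ/τ² + x)·t`, `b_x = b + x² + μ²/τ² − (μ/τ² + x)²·t`. -/
noncomputable def predDensity (μ τsq a b x z : ℝ) : ℝ :=
  let t : ℝ := (1 / τsq + 1)⁻¹
  let μx : ℝ := (μ / τsq + x) * t
  let bx : ℝ := b + x ^ 2 + μ ^ 2 / τsq - (μ / τsq + x) ^ 2 * t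
  Real.Gamma ((a + 2) / 2) / (Real.sqrt ((a + 1) * Real.pi) * Real.Gamma ((a + 1) / 2)) *
    (bx * (1 + t) / (a + 1)) ^ (-(1 / 2 : ℝ)) *
    (1 + (z - μx) ^ 2 / (bx * (1 + t))) ^ (-((a + 2) / 2))

/-- With `v = (μ/τ²)·t/(1 − t)`, for all `y₁ y₂ : ℝ` the following are
equivalent: (i) `p(y₂∣y₁) ≤ p(y₁∣y₂)`; (ii) `b_{y₁} ≤ b_{y₂}`;
(iii) `(y₁ − v)² ≤ (y₂ − v)²`. -/
theorem stmt3 (μ τsq a b : ℝ) (hτ : 0 < τsq) (ha : 0 < a) (hb : 0 < b) :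
    ∀ y₁ y₂ : ℝ,
      let t := (1 / τsq + 1)⁻¹
      let v := μ / τsq * t / (1 - t)
      let bx := fun x : ℝ => b + x ^ 2 + μ ^ 2 / τsq - (μ / τsq + x) ^ 2 * t
      (predDensity μ τsq a b y₁ y₂ ≤ predDensity μ τsq a b y₂ y₁ ↔ bx y₁ ≤ bx y₂) ∧
        (bx y₁ ≤ bx y₂ ↔ (y₁ - v) ^ 2 ≤ (y₂ - v) ^ 2) := by
  intro y₁ y₂ t v bx
  have ht : t = τsq / (1 + τsq) := by
    simp only [t]; field_simp
  have ht0 : 0 < t := by rw [ht]; positivity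
  have h1t : 1 - t = 1 / (1 + τsq) := by rw [ht]; field_simp; ring
  have h1t0 : 0 < 1 - t := by rw [h1t]; positivity
  have hv : v = μ := by
    simp only [v]; rw [h1t, ht]; field_simp
  have hbx : ∀ x, bx x = b + (x - μ) ^ 2 * (1 - t) := by
    intro x; simp only [bx]; rw [ht]; field_simp; ring
  have hpos : ∀ x, 0 < bx x := by
    intro x; rw [hbx]; positivity
  have key : ∀ x z, predDensity μ τsq a b x z =
      Real.Gamma ((a + 2) / 2) / (Real.sqrt ((a + 1) * Real.pi) * Real.Gamma ((a + 1) / 2)) *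
      (1 / (a + 1)) ^ (-(1 / 2 : ℝ)) *
      (bx x * (1 + t) + (z - (μ / τsq + x) * t) ^ 2) ^ (-((a + 2) / 2)) *
      (bx x * (1 + t)) ^ ((a + 1) / 2) := by
    intro x z
    have hB : 0 < bx x * (1 + t) := mul_pos (hpos x) (by linarith)
    have e : predDensity μ τsq a b x z =
      Real.Gamma ((a + 2) / 2) / (Real.sqrt ((a + 1) * Real.pi) * Real.Gamma ((a + 1) / 2)) *
      (bx x * (1 + t) / (a + 1)) ^ (-(1 / 2 : ℝ)) *
      (1 + (z - (μ / τsq + x) * t) ^ 2 / (bx x * (1 + t))) ^ (-((a + 2) / 2)) := rfl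
    rw [e]
    generalize bx x * (1 + t) = B at hB
    generalize (z - (μ / τsq + x) * t) = w
    have e1 : B / (a + 1) = (1 / (a + 1)) * B := by ring
    have e2 : 1 + w ^ 2 / B = (B + w ^ 2) / B := by field_simp
    rw [e1, e2, Real.mul_rpow (by positivity) hB.le, Real.div_rpow (by positivity) hB.le]
    have e3 : B ^ ((a + 1) / 2) = B ^ (-(1 / 2 : ℝ)) / B ^ (-((a + 2) / 2)) := by
      rw [← Real.rpow_sub hB]; congr 1; ring
    rw [e3]; ring
  have sym : bx y₁ * (1 + t) + (y₂ - (μ / τsq + y₁) * t) ^ 2 =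
      bx y₂ * (1 + t) + (y₁ - (μ / τsq + y₂) * t) ^ 2 := by
    simp only [bx]; ring
  refine ⟨?_, ?_⟩
  · rw [key, key, sym]
    have hB1 : 0 < bx y₁ * (1 + t) := mul_pos (hpos _) (by linarith)
    have hB2 : 0 < bx y₂ * (1 + t) := mul_pos (hpos _) (by linarith)
    have hG1 : 0 < Real.Gamma ((a + 2) / 2) := Real.Gamma_pos_of_pos (by positivity)
    have hG2 : 0 < Real.Gamma ((a + 1) / 2) := Real.Gamma_pos_of_pos (by positivity)
    have hpi := Real.pi_pos
    rw [mul_le_mul_iff_right₀ (by positivity), Real.rpow_le_rpow_iff hB1.le hB2.le (by positivity),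
      mul_le_mul_iff_left₀ (by linarith)]
  · rw [hbx, hbx, hv, add_le_add_iff_left, mul_le_mul_iff_left₀ h1t0]
end

section
/- Fix μ ∈ ℝ and τ² > 0, and set t = (1/τ² + 1)⁻¹, s = (1/τ² + 2)⁻¹, v = (μ/τ²)·t/(1 − t). For y₁, y₂ ∈ ℝ put m = (μ/τ² + y₁ + y₂)·s. Then (y₁ − m)² ≤ (y₂ − m)² if and only if (y₁ − v)² ≤ (y₂ − v)². -/
/-- Fix `μ ∈ ℝ`, `τ² > 0`, set `t = (1/τ² + 1)⁻¹`, `s = (1/τ² + 2)⁻¹`,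
`v = (μ/τ²)·t/(1 − t)`. For `y₁ y₂ : ℝ` put `m = (μ/τ² + y₁ + y₂)·s`. Then
`(y₁ − m)² ≤ (y₂ − m)² ↔ (y₁ − v)² ≤ (y₂ − v)²`. -/
theorem stmt4 (μ τsq : ℝ) (hτ : 0 < τsq) :
    ∀ y₁ y₂ : ℝ,
      let t := (1 / τsq + 1)⁻¹
      let s := (1 / τsq + 2)⁻¹
      let v := μ / τsq * t / (1 - t)
      let m := (μ / τsq + y₁ + y₂) * s
      ((y₁ - m) ^ 2 ≤ (y₂ - m) ^ 2 ↔ (y₁ - v) ^ 2 ≤ (y₂ - v) ^ 2) := by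
  intro y₁ y₂ t s v m
  have h1 : 0 < 1 + 2 * τsq := by linarith
  have h2 : 0 < 1 + τsq := by linarith
  have ht : t = τsq / (1 + τsq) := by
    simp only [t]
    field_simp
  have ht1 : 1 - t = 1 / (1 + τsq) := by
    rw [ht]
    field_simp
    ring
  have hv : v = μ := by
    simp only [v]
    rw [ht1, ht]
    field_simp
  have hs : s = τsq / (1 + 2 * τsq) := by
    simp only [s]
    field_simp
    try ring
  have hm : (1 + 2 * τsq) * m = μ + τsq * (y₁ + y₂) := by
    simp only [m]
    rw [hs]
    field_simp
    try ring
  have key : (1 + 2 * τsq) * ((y₂ - m) ^ 2 - (y₁ - m) ^ 2)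
      = (y₂ - μ) ^ 2 - (y₁ - μ) ^ 2 := by
    linear_combination (-2 * (y₂ - y₁)) * hm
  rw [hv, ← sub_nonneg, ← sub_nonneg (b := (y₁ - μ) ^ 2), ← key]
  exact (mul_nonneg_iff_of_pos_left h1).symm
end

section
/- (Equivalent conformity measures under the Normal working model.) Fix μ ∈ ℝ and τ², a, b > 0, set t = (1/τ² + 1)⁻¹ and s = (1/τ² + 2)⁻¹, and let p(z∣x) denote the posterior predictive density of the Normal working model given the single observation x evaluated at z. Then for all y₁, y₂ ∈ ℝ, with m = (μ/τ² + y₁ + y₂)·s: p(y₂∣y₁) ≤ p(y₁∣y₂) if and only if (y₁ − m)² ≤ (y₂ − m)². That is, the leave-one-out conformity comparison C_B(y₁, y₂) ≤ C_B(y₂, y₁) is equivalent to the augmented-data conformity comparison C_B({y₁,y₂}, y₂) ≤ C_B({y₁,y₂}, y₁), whose common posterior predictive density is centered at m. -/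
lemma aux_rpow (a C w d : ℝ) (ha : 0 < a) (hw : 0 < w) :
    C * (w / (a + 1)) ^ (-(1 / 2 : ℝ)) * (1 + d ^ 2 / w) ^ (-((a + 2) / 2))
      = C / (a + 1) ^ (-(1 / 2 : ℝ)) * (w + d ^ 2) ^ (-((a + 2) / 2)) * w ^ ((a + 1) / 2) := by
  have h1 : 1 + d ^ 2 / w = (w + d ^ 2) / w := by field_simp
  have h2 : w ^ ((a + 1) / 2) = w ^ (-(1 / 2 : ℝ)) / w ^ (-((a + 2) / 2)) := by
    rw [← Real.rpow_sub hw]; congr 1; ring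
  rw [h1, Real.div_rpow hw.le (by positivity), Real.div_rpow (by positivity) hw.le, h2]
  ring

theorem stmt5 (μ τsq a b : ℝ) (hτ : 0 < τsq) (ha : 0 < a) (hb : 0 < b) :
    ∀ y₁ y₂ : ℝ,
      let s := (1 / τsq + 2)⁻¹
      let m := (μ / τsq + y₁ + y₂) * s
      (predDensity μ τsq a b y₁ y₂ ≤ predDensity μ τsq a b y₂ y₁ ↔
        (y₁ - m) ^ 2 ≤ (y₂ - m) ^ 2) := by
  intro y₁ y₂ s m
  have hk : 0 < 1 / τsq := by positivity
  have hb' : ∀ x : ℝ, b + x ^ 2 + μ ^ 2 / τsq - (μ / τsq + x) ^ 2 * (1 / τsq + 1)⁻¹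
      = b + (x - μ) ^ 2 / (1 + τsq) := by
    intro x; field_simp; ring
  have ht : 0 < (1 / τsq + 1)⁻¹ := by positivity
  have hw : ∀ x : ℝ, 0 < (b + (x - μ) ^ 2 / (1 + τsq)) * (1 + (1 / τsq + 1)⁻¹) := by
    intro x; positivity
  have hQ : (b + (y₂ - μ) ^ 2 / (1 + τsq)) * (1 + (1 / τsq + 1)⁻¹)
        + (y₁ - (μ / τsq + y₂) * (1 / τsq + 1)⁻¹) ^ 2
      = (b + (y₁ - μ) ^ 2 / (1 + τsq)) * (1 + (1 / τsq + 1)⁻¹)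
        + (y₂ - (μ / τsq + y₁) * (1 / τsq + 1)⁻¹) ^ 2 := by
    field_simp; ring
  have hG1 : 0 < Real.Gamma ((a + 2) / 2) := Real.Gamma_pos_of_pos (by positivity)
  have hG2 : 0 < Real.Gamma ((a + 1) / 2) := Real.Gamma_pos_of_pos (by positivity)
  have hQp : 0 < (b + (y₁ - μ) ^ 2 / (1 + τsq)) * (1 + (1 / τsq + 1)⁻¹)
        + (y₂ - (μ / τsq + y₁) * (1 / τsq + 1)⁻¹) ^ 2 :=
    add_pos_of_pos_of_nonneg (hw y₁) (sq_nonneg _)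
  have hpi := Real.pi_pos
  simp only [predDensity, hb']
  rw [aux_rpow a _ _ _ ha (hw y₁), aux_rpow a _ _ _ ha (hw y₂), hQ,
    mul_le_mul_iff_right₀ (by positivity),
    Real.rpow_le_rpow_iff (hw y₁).le (hw y₂).le (by positivity),
    mul_le_mul_iff_left₀ (by positivity), add_le_add_iff_left,
    div_le_div_iff_of_pos_right (by positivity)]
  have key : (y₂ - m) ^ 2 - (y₁ - m) ^ 2
      = (1 / (1 + 2 * τsq)) * ((y₂ - μ) ^ 2 - (y₁ - μ) ^ 2) := by
    simp only [m, s]; field_simp; ring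
  have hc : 0 < 1 / (1 + 2 * τsq) := by positivity
  rw [← sub_nonneg, ← sub_nonneg (b := (y₁ - m) ^ 2), key, mul_nonneg_iff_of_pos_left hc]
end

section
/- For each i ∈ {1, …, n}, the sub-region of acceptance S_i = {x ∈ ℝ : (y_i − M(x))² ≥ (x − M(x))²} is exactly the closed interval [min{y_i, g(y_i)}, max{y_i, g(y_i)}], where g(y_i) = (2Cr − y_i)/(1 − 2r). -/
/-- With `C = μ/τ² + Σ y_k`, `r = (1/τ² + n + 1)⁻¹`, `M(x) = (C + x)·r`,
and `g(z) = (2Cr − z)/(1 − 2r)`, for each `i` the sub-region of acceptance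
`S_i = {x : (y_i − M(x))² ≥ (x − M(x))²}` is exactly the closed interval
`[min{y_i, g(y_i)}, max{y_i, g(y_i)}]`. -/
theorem stmt8 (n : ℕ) (hn : 1 ≤ n) (y : Fin n → ℝ) (μ τsq : ℝ) (hτ : 0 < τsq) :
    ∀ i : Fin n,
      let C := μ / τsq + ∑ k, y k
      let r := (1 / τsq + (n : ℝ) + 1)⁻¹
      let M := fun x : ℝ => (C + x) * r
      let g := fun z : ℝ => (2 * C * r - z) / (1 - 2 * r)
      {x : ℝ | (x - M x) ^ 2 ≤ (y i - M x) ^ 2} =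
        Set.Icc (min (y i) (g (y i))) (max (y i) (g (y i))) := by
  intro i C r M g
  have hn' : (1 : ℝ) ≤ n := by exact_mod_cast hn
  have hτ' : 0 < 1 / τsq := by positivity
  have hr : r < 1 / 2 := by
    have : (1 / τsq + (n : ℝ) + 1)⁻¹ < (2 : ℝ)⁻¹ :=
      inv_strictAnti₀ (by norm_num) (by linarith)
    simpa [r] using this
  have hd : 0 < 1 - 2 * r := by linarith
  have hg : (1 - 2 * r) * g (y i) = 2 * C * r - y i := by
    simp only [g]
    exact mul_div_cancel₀ _ hd.ne'
  generalize g (y i) = z at hg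
  ext x
  have key : (x - M x) ^ 2 - (y i - M x) ^ 2 = (1 - 2 * r) * ((x - y i) * (x - z)) := by
    simp only [M]
    linear_combination (x - y i) * hg
  have h1 : (x - M x) ^ 2 ≤ (y i - M x) ^ 2 ↔ (x - y i) * (x - z) ≤ 0 := by
    rw [← sub_nonpos, key]
    constructor
    · intro h
      by_contra hc
      push Not at hc
      exact absurd (mul_pos hd hc) (not_lt.mpr h)
    · intro h
      exact mul_nonpos_of_nonneg_of_nonpos hd.le h
  rw [Set.mem_setOf_eq, h1, Set.mem_Icc, min_le_iff, le_max_iff, mul_nonpos_iff]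
  constructor
  · rintro (⟨h, h'⟩ | ⟨h, h'⟩)
    · exact ⟨Or.inl (by linarith), Or.inr (by linarith)⟩
    · exact ⟨Or.inr (by linarith), Or.inl (by linarith)⟩
  · rintro ⟨h | h, h' | h'⟩
    · rcases le_total x z with hz | hz
      · exact Or.inl ⟨by linarith, by linarith⟩
      · exact Or.inr ⟨by linarith, by linarith⟩
    · exact Or.inl ⟨by linarith, by linarith⟩
    · exact Or.inr ⟨by linarith, by linarith⟩
    · rcases le_total x (y i) with hz | hz
      · exact Or.inr ⟨by linarith, by linarith⟩
      · exact Or.inl ⟨by linarith, by linarith⟩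
end

section
/- For each i ∈ {1, …, n}, the posterior mean estimator θ̃ = C·(1/τ² + n)⁻¹ lies in the interval [min{y_i, g(y_i)}, max{y_i, g(y_i)}], where g(y_i) = (2Cr − y_i)/(1 − 2r). Equivalently, θ̃ belongs to every sub-region of acceptance S_i = {x ∈ ℝ : (y_i − M(x))² ≥ (x − M(x))²}. -/
/-- With `C = μ/τ² + Σ y_k`, `r = (1/τ² + n + 1)⁻¹`, `M(x) = (C + x)·r`,
`g(z) = (2Cr − z)/(1 − 2r)`, the posterior mean estimator `θ̃ = C·(1/τ² + n)⁻¹` lies in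
the interval `[min{y_i, g(y_i)}, max{y_i, g(y_i)}]` for each `i`; equivalently, `θ̃`
belongs to every sub-region of acceptance `S_i = {x : (y_i − M(x))² ≥ (x − M(x))²}`. -/
theorem stmt9 (n : ℕ) (hn : 1 ≤ n) (y : Fin n → ℝ) (μ τsq : ℝ) (hτ : 0 < τsq) :
    ∀ i : Fin n,
      let C := μ / τsq + ∑ k, y k
      let r := (1 / τsq + (n : ℝ) + 1)⁻¹
      let M := fun x : ℝ => (C + x) * r
      let g := fun z : ℝ => (2 * C * r - z) / (1 - 2 * r)
      let θt := C * (1 / τsq + (n : ℝ))⁻¹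
      θt ∈ Set.Icc (min (y i) (g (y i))) (max (y i) (g (y i))) ∧
        (θt - M θt) ^ 2 ≤ (y i - M θt) ^ 2 := by
  intro i C r M g θt
  have hn' : (1 : ℝ) ≤ n := by exact_mod_cast hn
  have hp : 0 < 1 / τsq := by positivity
  obtain ⟨a, ha⟩ : ∃ a : ℝ, a = 1 / τsq + (n : ℝ) := ⟨_, rfl⟩
  have ha1 : 1 < a := by linarith
  have h0 : a ≠ 0 := by linarith
  have h1 : a + 1 ≠ 0 := by linarith
  have h2 : a - 1 ≠ 0 := by linarith
  have hr : r = (a + 1)⁻¹ := by simp only [r, ha]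
  have hθ : C = θt * a := by
    simp only [θt, ← ha]
    field_simp
  have hM : M θt = θt := by
    simp only [M, hr]
    rw [hθ]
    field_simp
  have hd : 1 - 2 * r = (a - 1) / (a + 1) := by
    rw [hr]
    field_simp
    ring
  have hg : g (y i) = θt + (a + 1) / (a - 1) * (θt - y i) := by
    simp only [g]
    rw [hd, hr, hθ]
    field_simp
    ring
  have hc : 0 < (a + 1) / (a - 1) := div_pos (by linarith) (by linarith)
  refine ⟨?_, ?_⟩
  · rw [Set.mem_Icc, hg]
    rcases le_total (y i) θt with h | h
    · have := mul_nonneg hc.le (sub_nonneg.2 h)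
      exact ⟨min_le_of_left_le h, le_max_of_le_right (by linarith)⟩
    · have := mul_nonneg hc.le (sub_nonneg.2 h)
      exact ⟨min_le_of_right_le (by linarith), le_max_of_le_left h⟩
  · rw [hM, sub_self]
    simpa using sq_nonneg (y i - θt)
end

section
/- (The FAB conformal prediction region under the Normal working model is an interval.) Define the counting function f(x) = 1 + #{i ∈ {1, …, n} : (y_i − M(x))² ≥ (x − M(x))²} for x ∈ ℝ. Then for every k ∈ ℕ, the set A_k = {x ∈ ℝ : f(x) > k} is order-connected (an interval), and if k ≤ n then θ̃ ∈ A_k. -/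
theorem aux_star (θ r t x v : ℝ) (hr : r ≤ 1/2) (ht0 : 0 ≤ t) (ht1 : t ≤ 1)
    (h : (x - (θ + (x - θ) * r)) ^ 2 ≤ (v - (θ + (x - θ) * r)) ^ 2) :
    ((θ + t * (x - θ)) - (θ + (t * (x - θ)) * r)) ^ 2
      ≤ (v - (θ + (t * (x - θ)) * r)) ^ 2 := by
  have h1 : 0 ≤ t * ((v - (θ + (x - θ) * r)) ^ 2 - (x - (θ + (x - θ) * r)) ^ 2) :=
    mul_nonneg ht0 (by linarith)
  have h2 : 0 ≤ (1 - t) * (v - θ) ^ 2 := mul_nonneg (by linarith) (sq_nonneg _)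
  have h3 : 0 ≤ (1 - 2 * r) * (x - θ) ^ 2 * (t * (1 - t)) :=
    mul_nonneg (mul_nonneg (by linarith) (sq_nonneg _)) (mul_nonneg ht0 (by linarith))
  nlinarith [h1, h2, h3]

/-- The FAB conformal prediction region under the Normal working model
is an interval: with `C = μ/τ² + Σ y_j`, `r = (1/τ² + n + 1)⁻¹`, `M(x) = (C + x)·r`,
`θ̃ = C·(1/τ² + n)⁻¹`, and counting function
`f(x) = 1 + #{i : (y_i − M(x))² ≥ (x − M(x))²}`, for every `k : ℕ` the set
`A_k = {x : f(x) > k}` is order-connected (an interval), and if `k ≤ n` then `θ̃ ∈ A_k`. -/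
theorem stmt10 (n : ℕ) (hn : 1 ≤ n) (y : Fin n → ℝ) (μ τsq : ℝ) (hτ : 0 < τsq) :
    ∀ k : ℕ,
      let C := μ / τsq + ∑ j, y j
      let r := (1 / τsq + (n : ℝ) + 1)⁻¹
      let M := fun x : ℝ => (C + x) * r
      let θt := C * (1 / τsq + (n : ℝ))⁻¹
      let f := fun x : ℝ => 1 + Nat.card {i : Fin n // (x - M x) ^ 2 ≤ (y i - M x) ^ 2}
      {x : ℝ | k < f x}.OrdConnected ∧ (k ≤ n → θt ∈ {x : ℝ | k < f x}) := by
  intro k C r M θt f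
  have hn' : (1 : ℝ) ≤ n := by exact_mod_cast hn
  have hs : (1 : ℝ) < 1 / τsq + n := by
    have : 0 < 1 / τsq := by positivity
    linarith
  have hr : r ≤ 1 / 2 := by
    show (1 / τsq + (n : ℝ) + 1)⁻¹ ≤ 1 / 2
    rw [one_div 2]
    exact inv_anti₀ (by norm_num) (by linarith)
  have hM : ∀ x, M x = θt + (x - θt) * r := by
    intro x
    show (C + x) * (1 / τsq + (n : ℝ) + 1)⁻¹ = C * (1 / τsq + (n : ℝ))⁻¹
      + (x - C * (1 / τsq + (n : ℝ))⁻¹) * (1 / τsq + (n : ℝ) + 1)⁻¹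
    generalize 1 / τsq + (n : ℝ) = s at hs
    have h1 : s ≠ 0 := by linarith
    have h2 : s + 1 ≠ 0 := by linarith
    field_simp
    ring
  have key : ∀ t x : ℝ, 0 ≤ t → t ≤ 1 → f x ≤ f (θt + t * (x - θt)) := by
    intro t x ht0 ht1
    refine Nat.add_le_add_left (Nat.card_le_card_of_injective
      (Subtype.map id fun i hi => ?_) (Subtype.map_injective _ Function.injective_id)) 1
    rw [hM] at hi ⊢
    have := aux_star θt r t x (y i) hr ht0 ht1 hi
    simpa only [id, add_sub_cancel_left] using this
  refine ⟨⟨?_⟩, ?_⟩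
  · intro a ha b hb x hx
    simp only [Set.mem_setOf_eq] at ha hb ⊢
    rcases lt_trichotomy x θt with h | h | h
    · have h0 : a - θt < 0 := by linarith [hx.1]
      have := key ((x - θt) / (a - θt)) a (div_nonneg_of_nonpos (by linarith) h0.le)
        ((div_le_one_of_neg h0).2 (by linarith [hx.1]))
      rw [div_mul_cancel₀ _ h0.ne, add_sub_cancel] at this
      exact ha.trans_le this
    · have := key 0 a le_rfl zero_le_one
      rw [zero_mul, add_zero, ← h] at this
      exact ha.trans_le this
    · have h0 : 0 < b - θt := by linarith [hx.2]
      have := key ((x - θt) / (b - θt)) b (div_nonneg (by linarith) h0.le)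
        ((div_le_one h0).2 (by linarith [hx.2]))
      rw [div_mul_cancel₀ _ h0.ne', add_sub_cancel] at this
      exact hb.trans_le this
  · intro hk
    have hc : Nat.card {i : Fin n // (θt - M θt) ^ 2 ≤ (y i - M θt) ^ 2} = n := by
      have hall : ∀ i : Fin n, (θt - M θt) ^ 2 ≤ (y i - M θt) ^ 2 := by
        intro i
        have : M θt = θt := by rw [hM]; ring
        rw [this, sub_self]
        nlinarith [sq_nonneg (y i - θt)]
      rw [Nat.card_congr (Equiv.subtypeUnivEquiv hall), Nat.card_fin]
    show k < 1 + Nat.card {i : Fin n // (θt - M θt) ^ 2 ≤ (y i - M θt) ^ 2}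
    rw [hc]
    omega
end

section
/- Let n ≥ 1 and let [a₁, b₁], …, [a_n, b_n] be closed intervals in ℝ all containing a common point c (i.e., a_i ≤ c ≤ b_i for all i). Then for every k with 1 ≤ k ≤ n, the set {y ∈ ℝ : #{i : a_i ≤ y ≤ b_i} ≥ k} equals the closed interval [a_(k), b_(n−k+1)], where a_(k) denotes the k-th smallest value among a₁, …, a_n and b_(n−k+1) the (n−k+1)-th smallest (i.e., k-th largest) value among b₁, …, b_n. -/
theorem cardA {n : ℕ} (a : Fin n → ℝ) (y : ℝ) (k : ℕ) (hk1 : 1 ≤ k) (hk : k - 1 < n) :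
    k ≤ Nat.card {i : Fin n // a i ≤ y} ↔ (a ∘ Tuple.sort a) ⟨k - 1, hk⟩ ≤ y := by
  have hm := Tuple.monotone_sort a
  have e : Nat.card {i : Fin n // a i ≤ y} =
      Nat.card {j : Fin n // (a ∘ Tuple.sort a) j ≤ y} :=
    Nat.card_congr ((Tuple.sort a).subtypeEquiv (fun j => Iff.rfl)).symm
  rw [e, Nat.card_eq_fintype_card, Fintype.card_subtype]
  constructor
  · intro h
    by_contra! hlt
    have : (Finset.univ.filter fun j => (a ∘ Tuple.sort a) j ≤ y) ⊆ Finset.Iio ⟨k - 1, hk⟩ := by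
      intro j hj
      rw [Finset.mem_filter] at hj
      rw [Finset.mem_Iio]
      by_contra! hle
      exact absurd (hm hle) (not_le.2 (lt_of_le_of_lt hj.2 hlt))
    have := Finset.card_le_card this
    rw [Fin.card_Iio] at this
    simp only at this
    omega
  · intro h
    have : Finset.Iic ⟨k - 1, hk⟩ ⊆ (Finset.univ.filter fun j => (a ∘ Tuple.sort a) j ≤ y) := by
      intro j hj
      rw [Finset.mem_Iic] at hj
      exact Finset.mem_filter.2 ⟨Finset.mem_univ _, (hm hj).trans h⟩
    have := Finset.card_le_card this
    rw [Fin.card_Iic] at this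
    simp only at this
    omega

theorem cardB {n : ℕ} (b : Fin n → ℝ) (y : ℝ) (k : ℕ) (hkn : k ≤ n) (hk : n - k < n) :
    k ≤ Nat.card {i : Fin n // y ≤ b i} ↔ y ≤ (b ∘ Tuple.sort b) ⟨n - k, hk⟩ := by
  have hm := Tuple.monotone_sort b
  have e : Nat.card {i : Fin n // y ≤ b i} =
      Nat.card {j : Fin n // y ≤ (b ∘ Tuple.sort b) j} :=
    Nat.card_congr ((Tuple.sort b).subtypeEquiv (fun j => Iff.rfl)).symm
  rw [e, Nat.card_eq_fintype_card, Fintype.card_subtype]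
  constructor
  · intro h
    by_contra! hlt
    have : (Finset.univ.filter fun j => y ≤ (b ∘ Tuple.sort b) j) ⊆ Finset.Ioi ⟨n - k, hk⟩ := by
      intro j hj
      rw [Finset.mem_filter] at hj
      rw [Finset.mem_Ioi]
      by_contra! hle
      exact absurd (hm hle) (not_le.2 (lt_of_lt_of_le hlt hj.2))
    have := Finset.card_le_card this
    rw [Fin.card_Ioi] at this
    simp only at this
    omega
  · intro h
    have : Finset.Ici ⟨n - k, hk⟩ ⊆ (Finset.univ.filter fun j => y ≤ (b ∘ Tuple.sort b) j) := by
      intro j hj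
      rw [Finset.mem_Ici] at hj
      exact Finset.mem_filter.2 ⟨Finset.mem_univ _, h.trans (hm hj)⟩
    have := Finset.card_le_card this
    rw [Fin.card_Ici] at this
    simp only at this
    omega

/-- Let `n ≥ 1` and let `[a₁,b₁], …, [a_n,b_n]` be closed intervals in `ℝ`
all containing a common point `c`. Then for every `k` with `1 ≤ k ≤ n`, the set
`{y : #{i : a i ≤ y ≤ b i} ≥ k}` equals the closed interval `[a_(k), b_(n−k+1)]`, where
`a_(k)` is the `k`-th smallest among the `a i` and `b_(n−k+1)` the `(n−k+1)`-th smallest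
(i.e. `k`-th largest) among the `b i`; order statistics are expressed via the sorting
permutation `Tuple.sort`. -/
theorem stmt11 (n : ℕ) (hn : 1 ≤ n) (a b : Fin n → ℝ) (c : ℝ)
    (hc : ∀ i, a i ≤ c ∧ c ≤ b i) :
    ∀ k : ℕ, ∀ _hk1 : 1 ≤ k, ∀ hkn : k ≤ n,
      {y : ℝ | k ≤ Nat.card {i : Fin n // a i ≤ y ∧ y ≤ b i}} =
        Set.Icc ((a ∘ Tuple.sort a) ⟨k - 1, by omega⟩)
          ((b ∘ Tuple.sort b) ⟨n - k, by omega⟩) := by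
  intro k hk1 hkn
  ext y
  rw [Set.mem_setOf_eq, Set.mem_Icc, ← cardA a y k hk1, ← cardB b y k hkn]
  constructor
  · intro h
    exact ⟨h.trans (Nat.card_le_card_of_injective _
        (Subtype.impEmbedding _ (fun i => a i ≤ y) (fun i hi => hi.1)).injective),
      h.trans (Nat.card_le_card_of_injective _
        (Subtype.impEmbedding _ (fun i => y ≤ b i) (fun i hi => hi.2)).injective)⟩
  · rintro ⟨h1, h2⟩
    rcases le_total y c with hy | hy
    · exact h1.trans (Nat.card_le_card_of_injective _
        (Subtype.impEmbedding _ (fun i => a i ≤ y ∧ y ≤ b i)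
          (fun i hi => ⟨hi, hy.trans (hc i).2⟩)).injective)
    · exact h2.trans (Nat.card_le_card_of_injective _
        (Subtype.impEmbedding _ (fun i => a i ≤ y ∧ y ≤ b i)
          (fun i hi => ⟨(hc i).1.trans hy, hi⟩)).injective)
end

section
/- (Correctness of the FAB conformal algorithm.) Let w ∈ ℝ^{2n} be the nondecreasing rearrangement of the 2n values y₁, …, y_n, g(y₁), …, g(y_n). Then for every k with 1 ≤ k ≤ n, the set {x ∈ ℝ : #{i ∈ {1, …, n} : (y_i − M(x))² ≥ (x − M(x))²} ≥ k} equals the closed interval [w_(k), w_(2n−k+1)], where w_(j) denotes the j-th smallest entry of w. -/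
theorem sorted_le_iff_aux {m : ℕ} (w : Fin m → ℝ) (j : Fin m) (x : ℝ) :
    (w ∘ Tuple.sort w) j ≤ x ↔ (j : ℕ) + 1 ≤ (Finset.univ.filter fun i => w i ≤ x).card := by
  have hm : Monotone (w ∘ Tuple.sort w) := Tuple.monotone_sort w
  have hc : (Finset.univ.filter fun i => w i ≤ x).card
      = (Finset.univ.filter fun i => (w ∘ Tuple.sort w) i ≤ x).card := by
    rw [Finset.card_filter, Finset.card_filter]
    exact (Equiv.sum_comp (Tuple.sort w) (fun i => if w i ≤ x then 1 else 0)).symm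
  rw [hc]
  constructor
  · intro h
    rw [← Fin.card_Iic]
    apply Finset.card_le_card
    intro i hi
    simp only [Finset.mem_Iic] at hi
    simp only [Finset.mem_filter, Finset.mem_univ, true_and]
    exact (hm hi).trans h
  · intro h
    by_contra hlt
    have : (Finset.univ.filter fun i => (w ∘ Tuple.sort w) i ≤ x) ⊆ Finset.Iio j := by
      intro i hi
      simp only [Finset.mem_filter, Finset.mem_univ, true_and] at hi
      rw [Finset.mem_Iio]
      by_contra hij
      exact hlt ((hm (not_lt.mp hij)).trans hi)
    have := Finset.card_le_card this
    rw [Fin.card_Iio] at this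
    omega

theorem le_sorted_iff_aux {m : ℕ} (w : Fin m → ℝ) (j : Fin m) (x : ℝ) :
    x ≤ (w ∘ Tuple.sort w) j ↔ m - (j : ℕ) ≤ (Finset.univ.filter fun i => x ≤ w i).card := by
  have hm : Monotone (w ∘ Tuple.sort w) := Tuple.monotone_sort w
  have hc : (Finset.univ.filter fun i => x ≤ w i).card
      = (Finset.univ.filter fun i => x ≤ (w ∘ Tuple.sort w) i).card := by
    rw [Finset.card_filter, Finset.card_filter]
    exact (Equiv.sum_comp (Tuple.sort w) (fun i => if x ≤ w i then 1 else 0)).symm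
  rw [hc]
  constructor
  · intro h
    rw [← Fin.card_Ici]
    apply Finset.card_le_card
    intro i hi
    simp only [Finset.mem_Ici] at hi
    simp only [Finset.mem_filter, Finset.mem_univ, true_and]
    exact h.trans (hm hi)
  · intro h
    by_contra hlt
    have : (Finset.univ.filter fun i => x ≤ (w ∘ Tuple.sort w) i) ⊆ Finset.Ioi j := by
      intro i hi
      simp only [Finset.mem_filter, Finset.mem_univ, true_and] at hi
      rw [Finset.mem_Ioi]
      by_contra hij
      exact hlt (hi.trans (hm (not_lt.mp hij)))
    have := Finset.card_le_card this
    rw [Fin.card_Ioi] at this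
    have := j.2
    omega


/-- Correctness of the FAB conformal algorithm: with
`C = μ/τ² + Σ y_j`, `r = (1/τ² + n + 1)⁻¹`, `M(x) = (C + x)·r`,
`g(z) = (2Cr − z)/(1 − 2r)`, let `w` be the tuple of the `2n` values
`y₁, …, y_n, g(y₁), …, g(y_n)` and let `w ∘ Tuple.sort w` be its nondecreasing
rearrangement. Then for every `k` with `1 ≤ k ≤ n`, the set
`{x : #{i : (y_i − M(x))² ≥ (x − M(x))²} ≥ k}` equals the closed interval
`[w_(k), w_(2n−k+1)]`. -/
theorem stmt12 (n : ℕ) (hn : 1 ≤ n) (y : Fin n → ℝ) (μ τsq : ℝ) (hτ : 0 < τsq) :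
    ∀ k : ℕ, ∀ _hk1 : 1 ≤ k, ∀ hkn : k ≤ n,
      let C := μ / τsq + ∑ j, y j
      let r := (1 / τsq + (n : ℝ) + 1)⁻¹
      let M := fun x : ℝ => (C + x) * r
      let g := fun z : ℝ => (2 * C * r - z) / (1 - 2 * r)
      let w : Fin (n + n) → ℝ := Fin.append y fun i => g (y i)
      {x : ℝ | k ≤ Nat.card {i : Fin n // (x - M x) ^ 2 ≤ (y i - M x) ^ 2}} =
        Set.Icc ((w ∘ Tuple.sort w) ⟨k - 1, by omega⟩)
          ((w ∘ Tuple.sort w) ⟨n + n - k, by omega⟩) := by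
  intro k hk1 hkn C r M g w
  have hn' : (1 : ℝ) ≤ n := by exact_mod_cast hn
  have hd : 2 < 1 / τsq + (n : ℝ) + 1 := by
    have : 0 < 1 / τsq := by positivity
    linarith
  have hr0 : 0 < r := inv_pos.mpr (by linarith)
  have hr : 0 < 1 - 2 * r := by
    have h1 : r * (1 / τsq + (n : ℝ) + 1) = 1 := inv_mul_cancel₀ (by linarith)
    nlinarith
  clear_value r
  clear_value C
  obtain ⟨θ, hθ⟩ : ∃ θ : ℝ, θ * (1 - r) = C * r :=
    ⟨C * r / (1 - r), div_mul_cancel₀ _ (by linarith)⟩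
  have hg : ∀ z, (1 - 2 * r) * (g z - θ) = θ - z := by
    intro z
    have : (1 - 2 * r) * g z = 2 * C * r - z := mul_div_cancel₀ _ hr.ne'
    linear_combination this - 2 * hθ
  have hgy : ∀ z, (z ≤ θ ∧ θ ≤ g z) ∨ (g z ≤ θ ∧ θ ≤ z) := by
    intro z
    rcases le_total z θ with h | h
    · left; refine ⟨h, ?_⟩
      by_contra hc
      nlinarith [hg z]
    · right; refine ⟨?_, h⟩
      by_contra hc
      nlinarith [hg z]
  have hcond : ∀ x z, (x - M x) ^ 2 ≤ (z - M x) ^ 2 ↔ 0 ≤ (z - x) * (x - g z) := by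
    intro x z
    have e : (z - M x) ^ 2 - (x - M x) ^ 2 = (1 - 2 * r) * ((z - x) * (x - g z)) := by
      have : (1 - 2 * r) * g z = 2 * C * r - z := mul_div_cancel₀ _ hr.ne'
      simp only [M]
      linear_combination (z - x) * this
    rw [← sub_nonneg, e, mul_nonneg_iff_of_pos_left hr]
  have hcond2 : ∀ x z, (x - M x) ^ 2 ≤ (z - M x) ^ 2 ↔
      (z ≤ x ∧ x ≤ g z) ∨ (g z ≤ x ∧ x ≤ z) := by
    intro x z
    rw [hcond, mul_nonneg_iff]
    simp only [sub_nonneg, sub_nonpos]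
    tauto
  clear_value M
  clear_value g
  ext x
  rw [Set.mem_ofPred_eq, Set.mem_Icc, sorted_le_iff_aux, le_sorted_iff_aux]
  have e1 : k - 1 + 1 = k := by omega
  have e2 : n + n - (n + n - k) = k := by omega
  simp only [e1, e2]
  rw [Nat.card_eq_fintype_card, Fintype.card_subtype, Finset.card_filter, Finset.card_filter,
    Finset.card_filter, Fin.sum_univ_add, Fin.sum_univ_add, ← Finset.sum_add_distrib,
    ← Finset.sum_add_distrib]
  simp only [w, Fin.append_left, Fin.append_right, hcond2]
  constructor
  · intro h
    refine ⟨h.trans (Finset.sum_le_sum fun i _ => ?_), h.trans (Finset.sum_le_sum fun i _ => ?_)⟩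
    · split_ifs <;> first | omega | (exfalso; tauto)
    · split_ifs <;> first | omega | (exfalso; tauto)
  · rintro ⟨h1, h2⟩
    rcases lt_trichotomy x θ with hx | hx | hx
    · refine h1.trans (Finset.sum_le_sum fun i _ => ?_)
      rcases hgy (y i) with ⟨ha, hb⟩ | ⟨ha, hb⟩ <;> split_ifs <;>
        first | omega | (exfalso; grind)
    · subst hx
      rw [Finset.sum_congr rfl (g := fun _ => 1)]
      · simpa using hkn
      · intro i _
        rw [if_pos (hgy (y i))]
    · refine h2.trans (Finset.sum_le_sum fun i _ => ?_)
      rcases hgy (y i) with ⟨ha, hb⟩ | ⟨ha, hb⟩ <;> split_ifs <;>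
        first | omega | (exfalso; grind)
end
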